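/- (Spectral bounds on the level set) Let S be a real symmetric p×p matrix such that v_{(i,j)} := S_{ii} + S_{jj} − 2 S_{ij} > 0 for every pair i > j, let γ > 0, λ ≥ 0, and let C ∈ ℝ. Then there exist constants β₁ > 0 and β₂ > 0 such that every L in the set L of connected-graph Laplacians satisfying Tr(L S) − log det(L + J) + ρ_MCP(L; λ) ≤ C obeys β₁ I ⪯ L + J ⪯ β₂ I. -/

import Mathlib

open Matrix BigOperators

/-- The `p × p` matrix all of whose entries are `1/p`. -/
noncomputable def matJ (p : ℕ) : Matrix (Fin p) (Fin p) ℝ :=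
  Matrix.of fun _ _ => (1 : ℝ) / p

/-- The set `𝓛` of connected-graph Laplacians. -/
def setL (p : ℕ) : Set (Matrix (Fin p) (Fin p) ℝ) :=
  {L | L.PosSemidef ∧ (∀ i j, i ≠ j → L i j ≤ 0) ∧ (∀ i, ∑ j, L i j = 0) ∧
    L.rank = p - 1}

/-- The scalar minimax concave penalty `MCP(x; γ, λ)`. -/
noncomputable def MCP (γ lam x : ℝ) : ℝ :=
  if |x| ≤ γ * lam then lam * |x| - x ^ 2 / (2 * γ) else γ * lam ^ 2 / 2

/-- The MCP penalty of a matrix: the sum of `MCP` over all off-diagonal entries. -/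
noncomputable def rhoMCP {p : ℕ} (γ lam : ℝ) (L : Matrix (Fin p) (Fin p) ℝ) : ℝ :=
  ∑ i, ∑ j ∈ Finset.univ.filter (fun j => j ≠ i), MCP γ lam (L i j)

lemma MCP_nonneg {γ lam : ℝ} (hγ : 0 < γ) (x : ℝ) : 0 ≤ MCP γ lam x := by
  unfold MCP
  split_ifs with h
  · rw [sub_nonneg, div_le_iff₀ (by positivity), ← sq_abs]
    nlinarith [abs_nonneg x, mul_nonneg (abs_nonneg x) (sub_nonneg.2 h),
      mul_nonneg ((abs_nonneg x).trans h) (abs_nonneg x)]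
  · positivity

lemma rhoMCP_nonneg {p : ℕ} {γ lam : ℝ} (hγ : 0 < γ)
    (L : Matrix (Fin p) (Fin p) ℝ) : 0 ≤ rhoMCP γ lam L :=
  Finset.sum_nonneg fun _ _ => Finset.sum_nonneg fun _ _ => MCP_nonneg hγ _

lemma exists_pos_forall_le_of_finite {ι : Type*} [Finite ι] (f : ι → ℝ) (hf : ∀ i, 0 < f i) :
    ∃ m, 0 < m ∧ ∀ i, m ≤ f i := by
  cases isEmpty_or_nonempty ι
  · exact ⟨1, one_pos, fun i => isEmptyElim i⟩
  · obtain ⟨i, hi⟩ := Finite.exists_min f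
    exact ⟨f i, hf i, hi⟩

/-- For a symmetric matrix with zero row sums, `Tr(L S)` is a weighted sum of the
quantities `S i i + S j j - 2 * S i j`. -/
lemma trace_mul_eq_sum_of_row_sum_zero {n : Type*} [Fintype n] {L S : Matrix n n ℝ}
    (hL : L.IsSymm) (hS : S.IsSymm) (hrow : ∀ i, ∑ j, L i j = 0) :
    (L * S).trace = ∑ i, ∑ j, -L i j * ((S i i + S j j - 2 * S i j) / 2) := by
  have h₁ : ∑ i, ∑ j, L i j * S i i = 0 := by
    simp [← Finset.sum_mul, hrow]
  have h₂ : ∑ i, ∑ j, L i j * S j j = 0 := by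
    rw [Finset.sum_comm]
    simp [← Finset.sum_mul, fun j i => (hL.apply j i), hrow]
  have h₃ : (L * S).trace = ∑ i, ∑ j, L i j * S i j := by
    simp [Matrix.trace, Matrix.mul_apply, fun j i => (hS.apply j i)]
  have h₄ : ∑ i, ∑ j, -L i j * ((S i i + S j j - 2 * S i j) / 2) =
      ∑ i, ∑ j, L i j * S i j - (∑ i, ∑ j, L i j * S i i) / 2
        - (∑ i, ∑ j, L i j * S j j) / 2 := by
    simp only [Finset.sum_div, ← Finset.sum_sub_distrib]
    refine Finset.sum_congr rfl fun i _ => Finset.sum_congr rfl fun j _ => ?_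
    ring
  rw [h₃, h₄, h₁, h₂]
  ring

lemma mul_trace_le_trace_mul {n : Type*} [Fintype n] {L S : Matrix n n ℝ}
    (hL : L.IsSymm) (hS : S.IsSymm) (hrow : ∀ i, ∑ j, L i j = 0)
    (hoff : ∀ i j, i ≠ j → L i j ≤ 0) {m : ℝ}
    (hm : ∀ i j, i ≠ j → m ≤ S i i + S j j - 2 * S i j) :
    m / 2 * L.trace ≤ (L * S).trace := by
  classical
  rw [trace_mul_eq_sum_of_row_sum_zero hL hS hrow, Matrix.trace, Finset.mul_sum]
  refine Finset.sum_le_sum fun i _ => ?_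
  have hdiag : L i i = ∑ j ∈ Finset.univ.erase i, -L i j := by
    have := Finset.add_sum_erase Finset.univ (L i) (Finset.mem_univ i)
    rw [Finset.sum_neg_distrib]
    linarith [hrow i]
  rw [← Finset.add_sum_erase Finset.univ _ (Finset.mem_univ i), Matrix.diag_apply, hdiag,
    Finset.mul_sum]
  have hself : (S i i + S i i - 2 * S i i) / 2 = 0 := by ring
  rw [hself, mul_zero, zero_add]
  refine Finset.sum_le_sum fun j hj => ?_
  have hij : i ≠ j := (Finset.ne_of_mem_erase hj).symm
  nlinarith [hoff i j hij, hm i j hij]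

lemma matJ_mulVec {p : ℕ} (x : Fin p → ℝ) :
    matJ p *ᵥ x = fun _ => (∑ i, x i) / p := by
  ext i
  simp [matJ, Matrix.mulVec, dotProduct, ← Finset.mul_sum, div_eq_inv_mul]

lemma posDef_add_matJ {p : ℕ} (hp : 2 ≤ p) {L : Matrix (Fin p) (Fin p) ℝ} (hL : L ∈ setL p) :
    (L + matJ p).PosDef := by
  obtain ⟨hpsd, -, hrow, hrank⟩ := hL
  have hp0 : (0 : ℝ) < p := by exact_mod_cast (by omega : 0 < p)
  have hJ : (matJ p).IsHermitian := by ext i j; simp [matJ]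
  refine Matrix.PosDef.of_dotProduct_mulVec_pos (hpsd.isHermitian.add hJ) fun x hx => ?_
  have hLx := hpsd.dotProduct_mulVec_nonneg x
  have hJx : star x ⬝ᵥ (matJ p *ᵥ x) = (∑ i, x i) ^ 2 / p := by
    rw [matJ_mulVec]
    simp only [dotProduct, ← Finset.sum_mul, Pi.star_apply, star_trivial]
    ring
  rw [Matrix.add_mulVec, dotProduct_add, hJx]
  by_contra hneg
  have hsq : 0 ≤ (∑ i, x i) ^ 2 / p := by positivity
  have hL0 : star x ⬝ᵥ (L *ᵥ x) = 0 := by linarith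
  have hs0 : ∑ i, x i = 0 := by
    have : (∑ i, x i) ^ 2 / p = 0 := by linarith
    simpa [hp0.ne'] using this
  have hker : L *ᵥ x = 0 := (hpsd.dotProduct_mulVec_zero_iff x).1 hL0
  have hone : L *ᵥ (fun _ => 1) = 0 := by
    ext i
    simpa [Matrix.mulVec, dotProduct] using hrow i
  have hdim : Module.finrank ℝ (LinearMap.ker L.mulVecLin) = 1 := by
    have := L.mulVecLin.finrank_range_add_finrank_ker
    rw [← Matrix.rank, hrank, Module.finrank_fin_fun] at this
    omega
  obtain ⟨c, hc⟩ := exists_smul_eq_of_finrank_eq_one hdim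
    (x := (⟨fun _ => 1, hone⟩ : LinearMap.ker L.mulVecLin))
    (fun h => one_ne_zero (congrFun (congrArg Subtype.val h) ⟨0, by omega⟩)) ⟨x, hker⟩
  have hcx : x = fun _ => c := by
    ext i
    simpa using (congrFun (congrArg Subtype.val hc) i).symm
  rw [hcx] at hs0
  have hc0 : c = 0 := by
    have : p ≠ 0 := by omega
    simpa [this] using hs0
  exact hx (by rw [hcx, hc0]; rfl)

lemma trace_matJ {p : ℕ} (hp : 2 ≤ p) : (matJ p).trace = 1 := by
  have : (p : ℝ) ≠ 0 := by exact_mod_cast (by omega : p ≠ 0)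
  simp [Matrix.trace, matJ, this]

section Spectral

variable {n : Type*} [Fintype n] [DecidableEq n] {M : Matrix n n ℝ}

lemma Matrix.IsHermitian.posSemidef_sub_smul_one (hM : M.IsHermitian) {β : ℝ}
    (h : ∀ i, β ≤ hM.eigenvalues i) : (M - β • (1 : Matrix n n ℝ)).PosSemidef := by
  have hd : (Matrix.diagonal fun i => hM.eigenvalues i - β).PosSemidef :=
    Matrix.PosSemidef.diagonal fun i => sub_nonneg.2 (h i)
  convert hd.mul_mul_conjTranspose_same (hM.eigenvectorUnitary : Matrix n n ℝ) using 1
  have hdiag : (Matrix.diagonal fun i => hM.eigenvalues i - β) =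
      Matrix.diagonal hM.eigenvalues - β • (1 : Matrix n n ℝ) := by
    rw [Matrix.smul_one_eq_diagonal, Matrix.diagonal_sub]
  have hU : (hM.eigenvectorUnitary : Matrix n n ℝ) * (hM.eigenvectorUnitary : Matrix n n ℝ)ᴴ = 1 :=
    Unitary.coe_mul_star_self _
  have hs := hM.spectral_theorem
  rw [Unitary.conjStarAlgAut_apply] at hs
  rw [hdiag, Matrix.mul_sub, Matrix.sub_mul, Matrix.mul_smul, Matrix.smul_mul, Matrix.mul_one, hU]
  exact congrArg (· - β • (1 : Matrix n n ℝ)) hs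

lemma Matrix.IsHermitian.posSemidef_smul_one_sub (hM : M.IsHermitian) {β : ℝ}
    (h : ∀ i, hM.eigenvalues i ≤ β) : (β • (1 : Matrix n n ℝ) - M).PosSemidef := by
  have hd : (Matrix.diagonal fun i => β - hM.eigenvalues i).PosSemidef :=
    Matrix.PosSemidef.diagonal fun i => sub_nonneg.2 (h i)
  convert hd.mul_mul_conjTranspose_same (hM.eigenvectorUnitary : Matrix n n ℝ) using 1
  have hdiag : (Matrix.diagonal fun i => β - hM.eigenvalues i) =
      β • (1 : Matrix n n ℝ) - Matrix.diagonal hM.eigenvalues := by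
    rw [Matrix.smul_one_eq_diagonal, Matrix.diagonal_sub]
  have hU : (hM.eigenvectorUnitary : Matrix n n ℝ) * (hM.eigenvectorUnitary : Matrix n n ℝ)ᴴ = 1 :=
    Unitary.coe_mul_star_self _
  have hs := hM.spectral_theorem
  rw [Unitary.conjStarAlgAut_apply] at hs
  rw [hdiag, Matrix.mul_sub, Matrix.sub_mul, Matrix.mul_smul, Matrix.smul_mul, Matrix.mul_one, hU]
  exact congrArg (β • (1 : Matrix n n ℝ) - ·) hs

lemma Matrix.PosDef.log_det_eq_sum (hM : M.PosDef) :
    Real.log M.det = ∑ i, Real.log (hM.isHermitian.eigenvalues i) := by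
  rw [hM.isHermitian.det_eq_prod_eigenvalues]
  exact Real.log_prod fun i _ => (hM.eigenvalues_pos i).ne'

lemma Matrix.PosDef.log_det_le (hM : M.PosDef) {a : ℝ} (ha : 0 < a) :
    Real.log M.det ≤ a * M.trace - Fintype.card n * (1 + Real.log a) := by
  have htr : M.trace = ∑ i, hM.isHermitian.eigenvalues i :=
    hM.isHermitian.trace_eq_sum_eigenvalues
  have hconst : (Fintype.card n : ℝ) * (1 + Real.log a) = ∑ _i : n, (1 + Real.log a) := by
    simp [mul_add]
  rw [hM.log_det_eq_sum, htr, Finset.mul_sum, hconst, ← Finset.sum_sub_distrib]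
  refine Finset.sum_le_sum fun i _ => ?_
  have hi := hM.eigenvalues_pos i
  have := Real.log_le_sub_one_of_pos (mul_pos ha hi)
  rw [Real.log_mul ha.ne' hi.ne'] at this
  linarith

lemma Matrix.PosDef.eigenvalues_le_trace (hM : M.PosDef) (i : n) :
    hM.isHermitian.eigenvalues i ≤ M.trace := by
  have htr : M.trace = ∑ i, hM.isHermitian.eigenvalues i :=
    hM.isHermitian.trace_eq_sum_eigenvalues
  rw [htr]
  exact Finset.single_le_sum (fun j _ => (hM.eigenvalues_pos j).le) (Finset.mem_univ i)

lemma Matrix.PosDef.exp_log_det_sub_trace_le_eigenvalues (hM : M.PosDef) (i : n) :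
    Real.exp (Real.log M.det - M.trace) ≤ hM.isHermitian.eigenvalues i := by
  have htr : M.trace = ∑ i, hM.isHermitian.eigenvalues i :=
    hM.isHermitian.trace_eq_sum_eigenvalues
  rw [← Real.le_log_iff_exp_le (hM.eigenvalues_pos i), hM.log_det_eq_sum, htr,
    ← Finset.add_sum_erase Finset.univ _ (Finset.mem_univ i),
    ← Finset.add_sum_erase Finset.univ hM.isHermitian.eigenvalues (Finset.mem_univ i)]
  have hsum : ∑ j ∈ Finset.univ.erase i, Real.log (hM.isHermitian.eigenvalues j) ≤
      ∑ j ∈ Finset.univ.erase i, hM.isHermitian.eigenvalues j :=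
    Finset.sum_le_sum fun j _ => Real.log_le_self (hM.eigenvalues_pos j).le
  linarith [hM.eigenvalues_pos i]

end Spectral

/-- spectral bounds on the level set: if
`v_{(i,j)} = S_{ii} + S_{jj} − 2 S_{ij} > 0` for all `i > j`, then there exist
`β₁, β₂ > 0` such that every `L ∈ 𝓛` with objective value at most `C` satisfies
`β₁ I ⪯ L + J ⪯ β₂ I`. -/
theorem level_set_spectral_bounds (p : ℕ) (hp : 2 ≤ p) (γ lam : ℝ)
    (hγ : 0 < γ) (hlam : 0 ≤ lam) (S : Matrix (Fin p) (Fin p) ℝ) (hS : S.IsSymm)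
    (hv : ∀ i j : Fin p, j < i → 0 < S i i + S j j - 2 * S i j) (C : ℝ) :
    ∃ β₁ β₂ : ℝ, 0 < β₁ ∧ 0 < β₂ ∧
      ∀ L ∈ setL p,
        (L * S).trace - Real.log (L + matJ p).det + rhoMCP γ lam L ≤ C →
          (L + matJ p - β₁ • (1 : Matrix (Fin p) (Fin p) ℝ)).PosSemidef ∧
            (β₂ • (1 : Matrix (Fin p) (Fin p) ℝ) - (L + matJ p)).PosSemidef := by
  obtain ⟨m, hm0, hm⟩ := exists_pos_forall_le_of_finite
    (fun q : {q : Fin p × Fin p // q.2 < q.1} =>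
      S q.1.1 q.1.1 + S q.1.2 q.1.2 - 2 * S q.1.1 q.1.2) fun q => hv _ _ q.2
  have hmS : ∀ i j : Fin p, i ≠ j → m ≤ S i i + S j j - 2 * S i j := by
    intro i j hij
    rcases lt_or_gt_of_ne hij with h | h
    · have := hm ⟨(j, i), h⟩
      simp only [hS.apply i j] at this
      linarith
    · exact hm ⟨(i, j), h⟩
  set B : ℝ := max 1 ((C + m / 2 - p * (1 + Real.log (m / 4))) / (m / 4))
  refine ⟨Real.exp (-C - B), B, Real.exp_pos _, lt_max_of_lt_left one_pos, fun L hL hobj => ?_⟩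
  have hM := posDef_add_matJ hp hL
  obtain ⟨hpsd, hoff, hrow, -⟩ := hL
  have hsymm : L.IsSymm := by simpa [Matrix.IsHermitian, Matrix.IsSymm] using hpsd.isHermitian
  have hρ := rhoMCP_nonneg (lam := lam) hγ L
  have htrS := mul_trace_le_trace_mul hsymm hS hrow hoff hmS
  have htrM : (L + matJ p).trace = L.trace + 1 := by rw [Matrix.trace_add, trace_matJ hp]
  have hlog := hM.log_det_le (a := m / 4) (by positivity)
  rw [Fintype.card_fin] at hlog
  have hT : (L + matJ p).trace ≤ B := by
    refine le_max_of_le_right ?_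
    rw [le_div_iff₀ (by positivity)]
    rw [htrM] at hlog ⊢
    linarith
  have htrL : 0 ≤ m / 2 * L.trace := mul_nonneg (by positivity) hpsd.trace_nonneg
  constructor
  · refine hM.isHermitian.posSemidef_sub_smul_one fun i => ?_
    refine le_trans (Real.exp_le_exp.2 ?_) (hM.exp_log_det_sub_trace_le_eigenvalues i)
    linarith
  · exact hM.isHermitian.posSemidef_smul_one_sub fun i => (hM.eigenvalues_le_trace i).trans hT
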